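/- arXiv:1309.3821 — 2 statements merged into one kernel-verified Lean document; each statement's English description precedes it below -/
import Mathlib

section
/- Let F = Q(√929) with w = (1+√929)/2. The genus 2 curve C : y^2 + (x^3+x+1) y = P(x) over F, where P(x) = 23x^6 + (90w−45)x^5 + 33601x^4 + (28707w−14354)x^3 + 3192149x^2 + (811953w−405977)x + 19904990, has discriminant Δ_C = 3^22. In particular the only prime of bad reduction of C is the (inert) prime (3). -/
open Polynomial

/-- The ring of integers `ℤ[w]` of `F = ℚ(√929)`, where `w = (1+√929)/2`
satisfies `w² = w + 232`. -/
noncomputable abbrev Osqrt929 : Type := AdjoinRoot (X ^ 2 - X - C 232 : Polynomial ℤ)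

noncomputable abbrev elt (a b : ℤ) : Osqrt929 :=
  AdjoinRoot.mk (X ^ 2 - X - C 232 : Polynomial ℤ) (C a + C b * X)

lemma monic_g : (X ^ 2 - X - C 232 : Polynomial ℤ).Monic := by monicity!

lemma exists_elt (x : Osqrt929) : ∃ a b, x = elt a b := by
  obtain ⟨p, rfl⟩ := AdjoinRoot.mk_surjective x
  have hd : (p %ₘ (X ^ 2 - X - C 232 : Polynomial ℤ)).natDegree ≤ 1 := by
    have h2 : (X ^ 2 - X - C 232 : Polynomial ℤ).natDegree = 2 := by compute_degree!
    have := natDegree_modByMonic_lt p monic_g (by intro h; rw [h] at h2; simp at h2)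
    omega
  obtain ⟨b, a, h⟩ := exists_eq_X_add_C_of_natDegree_le_one hd
  refine ⟨a, b, ?_⟩
  unfold elt
  rw [AdjoinRoot.mk_eq_mk]
  refine ⟨p /ₘ (X ^ 2 - X - C 232 : Polynomial ℤ), ?_⟩
  conv_lhs => rw [← modByMonic_add_div p (X ^ 2 - X - C 232 : Polynomial ℤ), h]
  ring

lemma elt_inj {a b c d : ℤ} (h : elt a b = elt c d) : a = c ∧ b = d := by
  unfold elt at h
  rw [AdjoinRoot.mk_eq_mk] at h
  have h2 : (X ^ 2 - X - C 232 : Polynomial ℤ).degree = 2 := by compute_degree!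
  have h0 := eq_zero_of_dvd_of_degree_lt h (by
    rw [h2]
    refine lt_of_le_of_lt (b := 1) ?_ (by norm_num)
    compute_degree)
  have e0 := congrArg (fun p => coeff p 0) h0
  have e1 := congrArg (fun p => coeff p 1) h0
  simp only [coeff_sub, coeff_add, coeff_C_mul, coeff_X, coeff_C, coeff_zero] at e0 e1
  norm_num at e0 e1
  constructor <;> omega

lemma elt_mul (a b c d : ℤ) :
    elt a b * elt c d = elt (a * c + 232 * (b * d)) (a * d + b * c + b * d) := by
  unfold elt
  rw [← map_mul, AdjoinRoot.mk_eq_mk]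
  refine ⟨C (b * d), ?_⟩
  simp only [map_add, map_mul, map_ofNat]
  ring

lemma three_eq : (3 : Osqrt929) = elt 3 0 := by
  simp only [elt, map_zero, zero_mul, add_zero, map_ofNat]

lemma three_dvd (a b : ℤ) : (3 : Osqrt929) ∣ elt a b ↔ 3 ∣ a ∧ 3 ∣ b := by
  constructor
  · rintro ⟨y, hy⟩
    obtain ⟨c, d, rfl⟩ := exists_elt y
    rw [three_eq, elt_mul] at hy
    obtain ⟨h1, h2⟩ := elt_inj hy
    omega
  · rintro ⟨⟨c, rfl⟩, ⟨d, rfl⟩⟩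
    refine ⟨elt c d, ?_⟩
    rw [three_eq, elt_mul]
    congr 1 <;> ring_nf

lemma zmod3 : ∀ a b c d : ZMod 3, a * c + 232 * (b * d) = 0 → a * d + b * c + b * d = 0 →
    (a = 0 ∧ b = 0) ∨ (c = 0 ∧ d = 0) := by decide

lemma prime_three : Prime (3 : Osqrt929) := by
  refine ⟨?_, ?_, ?_⟩
  · intro h
    have h0 : (0 : Osqrt929) = elt 0 0 := by simp [elt]
    rw [three_eq, h0] at h
    have := (elt_inj h).1
    omega
  · intro h
    have h1 : (1 : Osqrt929) = elt 1 0 := by simp [elt]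
    have := h.dvd (a := (1 : Osqrt929))
    rw [h1, three_dvd] at this
    omega
  · intro x y h
    obtain ⟨a, b, rfl⟩ := exists_elt x
    obtain ⟨c, d, rfl⟩ := exists_elt y
    rw [elt_mul, three_dvd] at h
    rw [three_dvd, three_dvd]
    obtain ⟨h1, h2⟩ := h
    have k1 := (ZMod.intCast_zmod_eq_zero_iff_dvd _ 3).2 h1
    have k2 := (ZMod.intCast_zmod_eq_zero_iff_dvd _ 3).2 h2
    push_cast at k1 k2
    have := zmod3 _ _ _ _ k1 k2
    simp only [ZMod.intCast_zmod_eq_zero_iff_dvd] at this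
    exact_mod_cast this

noncomputable def pA (s : ℂ) : ℂ[X] :=
  C (93) * X ^ 6 + C (180 * s) * X ^ 5 + C (134406) * X ^ 4 + C (57414 * s) * X ^ 3 + C (12768597) * X ^ 2 + C (1623906 * s) * X + C (79619961)

noncomputable def pB (s : ℂ) : ℂ[X] :=
  C (558) * X ^ 5 + C (900 * s) * X ^ 4 + C (537624) * X ^ 3 + C (172242 * s) * X ^ 2 + C (25537194) * X + C (1623906 * s)

noncomputable def pR4 (s : ℂ) : ℂ[X] :=
  C (-1546) * X ^ 4 + C (-2041 * s) * X ^ 3 + C (-934564) * X ^ 2 + C (-203695 * s) * X + C (-15376333)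

noncomputable def pR3 (s : ℂ) : ℂ[X] :=
  C (-23249) * X ^ 3 + C (-24354 * s) * X ^ 2 + C (-7899025) * X + C (-919145 * s)

noncomputable def pR2 (s : ℂ) : ℂ[X] :=
  C (51199) * X ^ 2 + C (36215 * s) * X + C (5947603)

noncomputable def pR1 (s : ℂ) : ℂ[X] :=
  C (-1729) * X + C (-604 * s)

noncomputable def pR0 (_ : ℂ) : ℂ[X] :=
  C (-1)

lemma euclid_step (A B R q : ℂ[X]) (c d : ℂ) (n : ℕ)
    (hB : B.natDegree ≤ n + 1) (hR : R.natDegree ≤ n) (hq : q.natDegree ≤ 1)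
    (h : C c * A = B * q + C d * R) :
    c ^ (n + 1) * resultant A B (n + 2) (n + 1) =
      d ^ (n + 1) * B.coeff (n + 1) ^ 2 * resultant B R (n + 1) n := by
  rw [← resultant_C_mul_left, h, add_comm (B * q),
    resultant_add_mul_left _ _ _ _ _ (by omega) hB, resultant_C_mul_left,
    resultant_add_left_deg _ _ _ _ _ hR, resultant_comm R B]
  have e1 : ((-1 : ℂ)) ^ ((n + 1) * 2) = 1 := Even.neg_one_pow (by simp)
  have e2 : ((-1 : ℂ)) ^ (n * (n + 1)) = 1 := Even.neg_one_pow (Nat.even_mul_succ_self n)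
  rw [e1, e2]
  ring

lemma step5 (s : ℂ) (hs : s ^ 2 = 929) :
    (186 : ℂ) ^ 5 * resultant (pA s) (pB s) 6 5 =
      (18 : ℂ) ^ 5 * (558) ^ 2 * resultant (pB s) (pR4 s) 5 4 := by
  have h := euclid_step (pA s) (pB s) (pR4 s) (C (31) * X + C (10 * s)) 186 18 4
    (by unfold pB; compute_degree) (by unfold pR4; compute_degree) (by compute_degree) (by
      have hS : (C s : ℂ[X]) ^ 2 = 929 := by rw [← C_pow, hs]; rfl
      unfold pA pB pR4
      simp only [map_mul, map_neg, map_ofNat, map_one]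
      linear_combination ((-16239060) * X ^ 0 + (-1722420) * X ^ 2 + (-9000) * X ^ 4) * hS)
  have hc : (pB s).coeff 5 = 558 := by
    unfold pB; compute_degree!
  rw [hc] at h
  exact h

lemma step4 (s : ℂ) (hs : s ^ 2 = 929) :
    (1195058 : ℂ) ^ 4 * resultant (pB s) (pR4 s) 5 4 =
      (837 : ℂ) ^ 4 * (-1546) ^ 2 * resultant (pR4 s) (pR3 s) 4 3 := by
  have h := euclid_step (pB s) (pR4 s) (pR3 s) (C (-431334) * X + C (-126261 * s)) 1195058 837 3
    (by unfold pR4; compute_degree) (by unfold pR3; compute_degree) (by compute_degree) (by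
      have hS : (C s : ℂ[X]) ^ 2 = 929 := by rw [← C_pow, hs]; rfl
      unfold pB pR4 pR3
      simp only [map_mul, map_neg, map_ofNat, map_one]
      linear_combination ((-25718734395) * X ^ 1 + (-257698701) * X ^ 3) * hS)
  have hc : (pR4 s).coeff 4 = -1546 := by
    unfold pR4; compute_degree!
  rw [hc] at h
  exact h

lemma step3 (s : ℂ) (hs : s ^ 2 = 929) :
    (540516001 : ℂ) ^ 3 * resultant (pR4 s) (pR3 s) 4 3 =
      (9560464 : ℂ) ^ 3 * (-23249) ^ 2 * resultant (pR3 s) (pR2 s) 3 2 := by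
  have h := euclid_step (pR4 s) (pR3 s) (pR2 s) (C (35942954) * X + C (9799925 * s)) 540516001 9560464 2
    (by unfold pR3; compute_degree) (by unfold pR2; compute_degree) (by compute_degree) (by
      have hS : (C s : ℂ[X]) ^ 2 = 929 := by rw [← C_pow, hs]; rfl
      unfold pR4 pR3 pR2
      simp only [map_mul, map_neg, map_ofNat, map_one]
      linear_combination ((9007552064125) * X ^ 0 + (238667373450) * X ^ 2) * hS)
  have hc : (pR3 s).coeff 3 = -23249 := by
    unfold pR3; compute_degree!
  rw [hc] at h
  exact h

lemma step2 (s : ℂ) (hs : s ^ 2 = 929) :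
    (2621337601 : ℂ) ^ 2 * resultant (pR3 s) (pR2 s) 3 2 =
      (1621548003 : ℂ) ^ 2 * (51199) ^ 2 * resultant (pR2 s) (pR1 s) 2 1 := by
  have h := euclid_step (pR3 s) (pR2 s) (pR1 s) (C (-1190325551) * X + C (-404937911 * s)) 2621337601 1621548003 1
    (by unfold pR2; compute_degree) (by unfold pR1; compute_degree) (by compute_degree) (by
      have hS : (C s : ℂ[X]) ^ 2 = 929 := by rw [← C_pow, hs]; rfl
      unfold pR3 pR2 pR1
      simp only [map_mul, map_neg, map_ofNat, map_one]
      linear_combination ((14664826446865) * X ^ 1) * hS)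
  have hc : (pR2 s).coeff 2 = 51199 := by
    unfold pR2; compute_degree!
  rw [hc] at h
  exact h

lemma step1 (s : ℂ) (hs : s ^ 2 = 929) :
    (2989441 : ℂ) ^ 1 * resultant (pR2 s) (pR1 s) 2 1 =
      (2621337601 : ℂ) ^ 1 * (-1729) ^ 2 * resultant (pR1 s) (pR0 s) 1 0 := by
  have h := euclid_step (pR2 s) (pR1 s) (pR0 s) (C (-88523071) * X + C (-31691539 * s)) 2989441 2621337601 0
    (by unfold pR1; compute_degree) (by unfold pR0; compute_degree) (by compute_degree) (by
      have hS : (C s : ℂ[X]) ^ 2 = 929 := by rw [← C_pow, hs]; rfl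
      unfold pR2 pR1 pR0
      simp only [map_mul, map_neg, map_ofNat, map_one]
      linear_combination ((-19141689556) * X ^ 0) * hS)
  have hc : (pR1 s).coeff 1 = -1729 := by
    unfold pR1; compute_degree!
  rw [hc] at h
  exact h

lemma res_value (s : ℂ) (hs : s ^ 2 = 929) :
    resultant (pA s) (pB s) 6 5 = -(93 * (2 ^ 12 * 3 ^ 22)) := by
  have h0 : resultant (pR1 s) (pR0 s) 1 0 = -1 := by
    rw [resultant_zero_right_deg]; simp [pR0]
  have k1 : resultant (pR2 s) (pR1 s) 2 1 = -2621337601 := by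
    have h := step1 s hs
    rw [h0] at h
    refine mul_left_cancel₀ (pow_ne_zero 1 (by norm_num : (2989441 : ℂ) ≠ 0)) (h.trans ?_)
    norm_num
  have k2 : resultant (pR3 s) (pR2 s) 3 2 = -2629417926033288009 := by
    have h := step2 s hs
    rw [k1] at h
    refine mul_left_cancel₀ (pow_ne_zero 2 (by norm_num : (2621337601 : ℂ) ≠ 0)) (h.trans ?_)
    norm_num
  have k3 : resultant (pR4 s) (pR3 s) 4 3 = -7864650378593902596096 := by
    have h := step3 s hs
    rw [k2] at h
    refine mul_left_cancel₀ (pow_ne_zero 3 (by norm_num : (540516001 : ℂ) ≠ 0)) (h.trans ?_)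
    norm_num
  have k4 : resultant (pB s) (pR4 s) 5 4 = -4523184449381376 := by
    have h := step4 s hs
    rw [k3] at h
    refine mul_left_cancel₀ (pow_ne_zero 4 (by norm_num : (1195058 : ℂ) ≠ 0)) (h.trans ?_)
    norm_num
  have k5 : resultant (pA s) (pB s) 6 5 = -11953924274737152 := by
    have h := step5 s hs
    rw [k4] at h
    refine mul_left_cancel₀ (pow_ne_zero 5 (by norm_num : (186 : ℂ) ≠ 0)) (h.trans ?_)
    norm_num
  rw [k5]; norm_num

lemma deriv_pA (s : ℂ) : derivative (pA s) = pB s := by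
  unfold pA pB
  simp only [derivative_add, derivative_C_mul, derivative_X_pow, derivative_X, derivative_C]
  norm_num [map_ofNat]
  ring

lemma exists_roots (s : ℂ) : ∃ r : Fin 6 → ℂ, pA s = C 93 * ∏ i, (X - C (r i)) := by
  have hd : (pA s).natDegree = 6 := by unfold pA; compute_degree!
  have hc : (pA s).leadingCoeff = 93 := by
    rw [leadingCoeff, hd]; unfold pA; compute_degree!
  have hs : (pA s).Splits := IsAlgClosed.splits _
  have hcard := hs.natDegree_eq_card_roots
  rw [hd] at hcard
  obtain ⟨l, hl⟩ : ∃ l : List ℂ, (pA s).roots = l := ⟨_, (Multiset.coe_toList _).symm⟩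
  rw [hl, Multiset.coe_card] at hcard
  obtain ⟨a, b, c, d, e, f, rfl⟩ : ∃ a b c d e f, l = [a, b, c, d, e, f] := by
    match l, hcard with
    | [a, b, c, d, e, f], _ => exact ⟨a, b, c, d, e, f, rfl⟩
  refine ⟨![a, b, c, d, e, f], ?_⟩
  conv_lhs => rw [hs.eq_prod_roots, hc, hl, Multiset.map_coe, Multiset.prod_coe]
  simp [Fin.prod_univ_six, mul_assoc]

lemma disc_value (s : ℂ) (hs : s ^ 2 = 929) (r : Fin 6 → ℂ)
    (h : pA s = C 93 * ∏ i, (X - C (r i))) :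
    (93 : ℂ) ^ 10 * ∏ p ∈ Finset.univ.filter (fun p : Fin 6 × Fin 6 => p.1 < p.2),
          (r p.1 - r p.2) ^ 2 = 2 ^ 12 * 3 ^ 22 := by
  have hres := res_value s hs
  have hB : (pB s).natDegree ≤ 5 := by unfold pB; compute_degree
  have hR : resultant (pA s) (pB s) 6 5 = 93 ^ 5 * ∏ i, (pB s).eval (r i) := by
    rw [h, resultant_C_mul_left]
    have := resultant_prod_left Finset.univ (fun i => X - C (r i)) (pB s) 5 (by simp) hB
    have hn : (∏ i : Fin 6, (X - C (r i))).natDegree = 6 := by simp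
    rw [hn] at this
    rw [this]
    simp [resultant_X_sub_C_left _ _ _ hB]
  rw [hR, ← deriv_pA, h] at hres
  simp only [Fin.prod_univ_six, derivative_mul, derivative_sub, derivative_X, derivative_C,
    eval_mul, eval_add, eval_sub, eval_X, eval_C, eval_zero, eval_one,
    sub_self, mul_zero, zero_mul, add_zero, zero_add, sub_zero, one_mul, mul_one] at hres
  have hf : (Finset.univ.filter (fun p : Fin 6 × Fin 6 => p.1 < p.2)) =
    {(0,1),(0,2),(0,3),(0,4),(0,5),(1,2),(1,3),(1,4),(1,5),(2,3),(2,4),(2,5),(3,4),(3,5),(4,5)} := by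
    decide
  rw [hf]
  rw [Finset.prod_insert (by decide)]
  iterate 13 rw [Finset.prod_insert (by decide)]
  rw [Finset.prod_singleton]
  dsimp only
  simp only [← neg_sub (r 0) (r 1),
    ← neg_sub (r 0) (r 2),
    ← neg_sub (r 0) (r 3),
    ← neg_sub (r 0) (r 4),
    ← neg_sub (r 0) (r 5),
    ← neg_sub (r 1) (r 2),
    ← neg_sub (r 1) (r 3),
    ← neg_sub (r 1) (r 4),
    ← neg_sub (r 1) (r 5),
    ← neg_sub (r 2) (r 3),
    ← neg_sub (r 2) (r 4),
    ← neg_sub (r 2) (r 5),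
    ← neg_sub (r 3) (r 4),
    ← neg_sub (r 3) (r 5),
    ← neg_sub (r 4) (r 5)] at hres
  generalize r 0 - r 1 = d01 at hres ⊢
  generalize r 0 - r 2 = d02 at hres ⊢
  generalize r 0 - r 3 = d03 at hres ⊢
  generalize r 0 - r 4 = d04 at hres ⊢
  generalize r 0 - r 5 = d05 at hres ⊢
  generalize r 1 - r 2 = d12 at hres ⊢
  generalize r 1 - r 3 = d13 at hres ⊢
  generalize r 1 - r 4 = d14 at hres ⊢
  generalize r 1 - r 5 = d15 at hres ⊢
  generalize r 2 - r 3 = d23 at hres ⊢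
  generalize r 2 - r 4 = d24 at hres ⊢
  generalize r 2 - r 5 = d25 at hres ⊢
  generalize r 3 - r 4 = d34 at hres ⊢
  generalize r 3 - r 5 = d35 at hres ⊢
  generalize r 4 - r 5 = d45 at hres ⊢
  linear_combination (-1 / 93) * hres

/-- the genus 2 curve `C : y² + (x³+x+1)y = P(x)` over
`F = ℚ(√929) ⊆ ℝ` (with `w = (1+√929)/2`) has discriminant `Δ_C = 3²²`:
writing the sextic `f = 4P + Q²` with leading coefficient `ℓ` and roots `r i`
in `ℂ`, Liu's discriminant `2⁻¹²·ℓ¹⁰·∏_{i<j}(rᵢ-rⱼ)²` equals `3²²`.  In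
particular `3` is inert in `O_F = ℤ[w]` and every prime ideal of `O_F`
containing `Δ_C` contains `3`, so the only prime of possible bad reduction of
`C` is the inert prime `(3)`. -/
theorem stmt4 :
    let w : ℝ := (1 + Real.sqrt 929) / 2
    let Q : Polynomial ℝ := X ^ 3 + X + 1
    let P : Polynomial ℝ :=
      C 23 * X ^ 6 + C (90 * w - 45) * X ^ 5 + C 33601 * X ^ 4 +
        C (28707 * w - 14354) * X ^ 3 + C 3192149 * X ^ 2 +
        C (811953 * w - 405977) * X + C 19904990
    let f : Polynomial ℝ := 4 * P + Q ^ 2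
    let φ := algebraMap ℝ ℂ
    let ℓ : ℂ := φ (f.coeff 6)
    (∃ r : Fin 6 → ℂ,
      f.map φ = C ℓ * ∏ i, (X - C (r i)) ∧
      ℓ ^ 10 * ∏ p ∈ Finset.univ.filter (fun p : Fin 6 × Fin 6 => p.1 < p.2),
          (r p.1 - r p.2) ^ 2 = φ (2 ^ 12 * 3 ^ 22)) ∧
    Prime (3 : Osqrt929) ∧
    (∀ p : Ideal Osqrt929, p.IsPrime → (3 : Osqrt929) ^ 22 ∈ p →
      (3 : Osqrt929) ∈ p) := by
  intro w Q P f φ ℓ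
  have hs : ((Real.sqrt 929 : ℝ) : ℂ) ^ 2 = 929 := by
    rw [← Complex.ofReal_pow, Real.sq_sqrt (by norm_num)]; norm_num
  have hf : f = C 93 * X ^ 6 + C (180 * √929) * X ^ 5 + C 134406 * X ^ 4 +
      C (57414 * √929) * X ^ 3 + C 12768597 * X ^ 2 + C (1623906 * √929) * X + C 79619961 := by
    have hw : (2 : ℝ[X]) * C w = 1 + C √929 := by
      rw [← C_1, ← C_add, show (2 : ℝ[X]) = C 2 from rfl, ← C_mul]
      congr 1
      simp only [w]; ring
    simp only [f, P, Q, map_sub, map_mul, map_ofNat]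
    linear_combination (180 * X ^ 5 + 57414 * X ^ 3 + 1623906 * X) * hw
  have hl : ℓ = 93 := by
    have : f.coeff 6 = 93 := by rw [hf]; compute_degree!
    simp only [ℓ, this, map_ofNat]
  have hfm : f.map φ = pA (√929 : ℝ) := by
    rw [hf]
    unfold pA
    simp [φ, Polynomial.map_add, Polynomial.map_mul]
  refine ⟨?_, prime_three, fun p hp h => hp.mem_of_pow_mem _ h⟩
  obtain ⟨r, hr⟩ := exists_roots (√929 : ℝ)
  refine ⟨r, ?_, ?_⟩
  · rw [hfm, hl, hr]
  · rw [hl, disc_value _ hs r hr]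
    simp [φ]
end

section
/- The Jacobian of the genus 2 curve C over F = Q(√53) of Theorem 'ex-sqrt53' has a rational point of order 7: with P = (α, (−6w−12)α + 2w + 18) and its conjugate σ'(P) under the involution of L = F(α) over F, the divisor D = P + σ'(P) − 2∞ of degree zero on C satisfies 7D ∼ 0 (7D is a principal divisor) while D itself is not principal; hence D defines an element of order exactly 7 in Pic^0(C)(F). -/
open Polynomial

noncomputable section

/-- `w = (1+√53)/2 ∈ F = ℚ(√53) ⊆ ℝ`. -/
def w53 : ℝ := (1 + Real.sqrt 53) / 2

/-- `Q(x) = wx³ + wx² + w + 1`. -/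
def Q53 : Polynomial ℝ := C w53 * X ^ 3 + C w53 * X ^ 2 + C (w53 + 1)

/-- `P(x) = -4x⁶ + (w-17)x⁵ + (12w-27)x⁴ + (5w-122)x³ + (45w-25)x² + (-9w-137)x + 14w + 9`. -/
def P53 : Polynomial ℝ :=
  C (-4) * X ^ 6 + C (w53 - 17) * X ^ 5 + C (12 * w53 - 27) * X ^ 4 +
    C (5 * w53 - 122) * X ^ 3 + C (45 * w53 - 25) * X ^ 2 +
    C (-9 * w53 - 137) * X + C (14 * w53 + 9)

/-- The affine coordinate ring `F[x,y]/(y² + Q(x)y - P(x))` of the genus 2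
curve `C : y² + Q(x)y = P(x)` of Theorem `ex-sqrt53`. -/
abbrev CoordRing53 : Type := AdjoinRoot (X ^ 2 + C Q53 * X - C P53 : Polynomial (Polynomial ℝ))

/-- The ideal of the degree-2 effective divisor `P + σ'(P)`, where
`P = (α, (-6w-12)α + 2w + 18)`, `α` a root of `x² - wx + 3`, and `σ'` the
nontrivial automorphism of `F(α)/F`: it is generated by `x² - wx + 3` and
`y - ((-6w-12)x + 2w + 18)`. -/
def I53 : Ideal CoordRing53 :=
  Ideal.span
    { AdjoinRoot.of _ (X ^ 2 - C w53 * X + C 3),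
      AdjoinRoot.root _ - AdjoinRoot.of _ (C (-6 * w53 - 12) * X + C (2 * w53 + 18)) }

/-! ### Generic lemmas -/

/-- Two field extensions of `K` embed in a common field. -/
theorem common_ext53 (K A B : Type) [Field K] [Field A] [Field B] [Algebra K A] [Algebra K B] :
    ∃ (Ω : Type) (_ : Field Ω) (i : A →+* Ω) (j : B →+* Ω),
      ∀ x : K, i (algebraMap K A x) = j (algebraMap K B x) := by
  have : Nontrivial (TensorProduct K A B) :=
    Algebra.TensorProduct.nontrivial_of_algebraMap_injective_of_flat_left K A B
      (algebraMap K B).injective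
  obtain ⟨m, hm⟩ := Ideal.exists_maximal (TensorProduct K A B)
  refine ⟨TensorProduct K A B ⧸ m, Ideal.Quotient.field m,
    (Ideal.Quotient.mk m).comp (Algebra.TensorProduct.includeLeftRingHom),
    (Ideal.Quotient.mk m).comp
      (Algebra.TensorProduct.includeRight : B →ₐ[K] TensorProduct K A B).toRingHom, ?_⟩
  intro x
  simp only [RingHom.comp_apply]
  congr 1
  have h1 := (Algebra.TensorProduct.includeRight : B →ₐ[K] TensorProduct K A B).commutes x
  have h2 := (Algebra.TensorProduct.includeLeft : A →ₐ[K] TensorProduct K A B).commutes x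
  exact h2.trans h1.symm

/-- The degree argument: `f = a + b y`, `f' = a' + b' y` of small norm with leading terms at
opposite places at infinity have product `f f'` without `y`-term. -/
theorem degree_arg53 {L : Type} [Field L] (w s₁ s₂ : L) (hne : s₁ ≠ s₂) (hsum : s₁ + s₂ = -w)
    (hprod : s₁ * s₂ = 4) (Q P a b a' b' N N' : L[X]) (n : ℕ)
    (hQ : Q.natDegree ≤ 3) (hQ3 : Q.coeff 3 = w) (hP : P.natDegree ≤ 6) (hP6 : P.coeff 6 = -4)
    (ha : a.natDegree ≤ n + 3) (ha' : a'.natDegree ≤ n + 3)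
    (hb : b.natDegree ≤ n) (hb' : b'.natDegree ≤ n)
    (hb0 : b.coeff n ≠ 0) (hb0' : b'.coeff n ≠ 0)
    (ha0 : a.coeff (n + 3) = -(b.coeff n * s₁)) (ha0' : a'.coeff (n + 3) = -(b'.coeff n * s₂))
    (hN : a ^ 2 - a * b * Q - b ^ 2 * P = N) (hN' : a' ^ 2 - a' * b' * Q - b' ^ 2 * P = N')
    (hNd : N.natDegree ≤ 2) (hNd' : N'.natDegree ≤ 2) :
    a * b' + a' * b - b * b' * Q = 0 := by
  by_contra hB
  set B := a * b' + a' * b - b * b' * Q with hBdef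
  set E := 2 * (a * a') - 2 * (b * Q * a') - 2 * (b * b' * P) - Q * (a * b') + Q * (a' * b) with hE
  have key : B * E = N * (2 * (a' * b') - b' * b' * Q) - N' * (-(2 * (a * b)) + b * b * Q) := by
    rw [← hN, ← hN', hBdef, hE]; ring
  have hbb : (b * b').natDegree ≤ n + n := natDegree_mul_le_of_le hb hb'
  have hbQ : (b * Q).natDegree ≤ n + 3 := natDegree_mul_le_of_le hb hQ
  have hab' : (a * b').natDegree ≤ n + 3 + n := natDegree_mul_le_of_le ha hb'
  have ha'b : (a' * b).natDegree ≤ n + 3 + n := natDegree_mul_le_of_le ha' hb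
  have e1 : (a * a').coeff (2 * n + 6) = a.coeff (n + 3) * a'.coeff (n + 3) := by
    rw [← coeff_mul_add_eq_of_natDegree_le ha ha']; congr 1; ring
  have e2 : (b * Q * a').coeff (2 * n + 6) = b.coeff n * w * a'.coeff (n + 3) := by
    rw [← hQ3, ← coeff_mul_add_eq_of_natDegree_le hb hQ,
      ← coeff_mul_add_eq_of_natDegree_le hbQ ha']; congr 1; ring
  have e3 : (b * b' * P).coeff (2 * n + 6) = b.coeff n * b'.coeff n * (-4) := by
    rw [← hP6, ← coeff_mul_add_eq_of_natDegree_le hb hb',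
      ← coeff_mul_add_eq_of_natDegree_le hbb hP]; congr 1; ring
  have e4 : (Q * (a * b')).coeff (2 * n + 6) = w * (a.coeff (n + 3) * b'.coeff n) := by
    rw [← hQ3, ← coeff_mul_add_eq_of_natDegree_le ha hb',
      ← coeff_mul_add_eq_of_natDegree_le hQ hab']; congr 1; ring
  have e5 : (Q * (a' * b)).coeff (2 * n + 6) = w * (a'.coeff (n + 3) * b.coeff n) := by
    rw [← hQ3, ← coeff_mul_add_eq_of_natDegree_le ha' hb,
      ← coeff_mul_add_eq_of_natDegree_le hQ ha'b]; congr 1; ring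
  have two : (2 : L[X]) = C 2 := (map_ofNat C 2).symm
  have hEc : E.coeff (2 * n + 6) = -(b.coeff n * b'.coeff n * (s₁ - s₂) ^ 2) := by
    rw [hE]
    simp only [two, coeff_add, coeff_sub, coeff_C_mul]
    rw [e1, e2, e3, e4, e5, ha0, ha0']
    have hw : w = -(s₁ + s₂) := by rw [hsum]; ring
    rw [hw]
    linear_combination (-2 * b.coeff n * b'.coeff n) * hprod
  have hEne : E.coeff (2 * n + 6) ≠ 0 := by
    rw [hEc]
    exact neg_ne_zero.mpr (mul_ne_zero (mul_ne_zero hb0 hb0') (pow_ne_zero 2 (sub_ne_zero.mpr hne)))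
  have hE0 : E ≠ 0 := by rintro h; rw [h] at hEne; simp at hEne
  have hdeg : 2 * n + 6 ≤ (B * E).natDegree := by
    rw [natDegree_mul hB hE0]
    have := le_natDegree_of_ne_zero hEne
    omega
  have hdeg2 : (B * E).natDegree ≤ 2 * n + 5 := by
    rw [key]
    have d1 : (a' * b').natDegree ≤ 2 * n + 3 :=
      (natDegree_mul_le_of_le ha' hb').trans (by omega)
    have d2 : (b' * b' * Q).natDegree ≤ 2 * n + 3 :=
      (natDegree_mul_le_of_le (natDegree_mul_le_of_le hb' hb') hQ).trans (by omega)
    have d3 : (a * b).natDegree ≤ 2 * n + 3 :=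
      (natDegree_mul_le_of_le ha hb).trans (by omega)
    have d4 : (b * b * Q).natDegree ≤ 2 * n + 3 :=
      (natDegree_mul_le_of_le (natDegree_mul_le_of_le hb hb) hQ).trans (by omega)
    have d5 : (2 * (a' * b') - b' * b' * Q).natDegree ≤ 2 * n + 3 := by
      rw [two]
      exact natDegree_sub_le_of_le ((natDegree_C_mul_le _ _).trans d1) d2 |>.trans (by simp)
    have d6 : (-(2 * (a * b)) + b * b * Q).natDegree ≤ 2 * n + 3 := by
      rw [two]
      refine (natDegree_add_le_of_le (m := 2 * n + 3) (n := 2 * n + 3) ?_ d4).trans (by simp)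
      rw [natDegree_neg]
      exact (natDegree_C_mul_le _ _).trans d3
    refine (natDegree_sub_le_of_le (natDegree_mul_le_of_le hNd d5)
      (natDegree_mul_le_of_le hNd' d6)).trans ?_
    rw [max_self]; omega
  omega

/-- `√53` is irrational: `X² - 53` is irreducible over `ℚ`. -/
theorem irr_rat53 : Irreducible (X ^ 2 - C 53 : ℚ[X]) := by
  refine X_pow_sub_C_irreducible_of_prime Nat.prime_two ?_
  intro b hb
  have h : Irrational (Real.sqrt 53) := by
    have : Nat.Prime 53 := by norm_num
    exact_mod_cast this.irrational_sqrt
  apply h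
  refine ⟨|b|, ?_⟩
  have hb2 : ((b : ℝ)) ^ 2 = 53 := by exact_mod_cast hb
  rw [← hb2, Real.sqrt_sq_eq_abs]
  push_cast; rfl

/-- Two embeddings of `ℝ` in a field which agree at `w` and differ by a sign at a square root
of `w - 3`. -/
theorem two_embeddings53 (θ : ℝ) (hθ : θ ^ 2 = w53 - 3) :
    ∃ (Ω : Type) (_ : Field Ω) (i j : ℝ →+* Ω), i w53 = j w53 ∧ i θ = - j θ := by
  have s53 : Real.sqrt 53 ^ 2 = 53 := Real.sq_sqrt (by norm_num)
  have : Fact (Irreducible (X ^ 2 - C 53 : ℚ[X])) := ⟨irr_rat53⟩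
  let K₀ := AdjoinRoot (X ^ 2 - C 53 : ℚ[X])
  let ι₁ : K₀ →+* ℝ := AdjoinRoot.lift (algebraMap ℚ ℝ) (Real.sqrt 53) (by
    simp [s53])
  let ι₂ : K₀ →+* ℝ := AdjoinRoot.lift (algebraMap ℚ ℝ) (-Real.sqrt 53) (by
    simp [s53])
  let t : K₀ := (-5 + AdjoinRoot.root _) / 2
  have hr1 : ι₁ (AdjoinRoot.root _) = Real.sqrt 53 := AdjoinRoot.lift_root _
  have hr2 : ι₂ (AdjoinRoot.root _) = -Real.sqrt 53 := AdjoinRoot.lift_root _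
  have ht1 : ι₁ t = w53 - 3 := by
    simp only [t, map_div₀, map_add, map_neg, hr1, map_ofNat, w53]; ring
  have ht2 : ι₂ t = (-5 - Real.sqrt 53) / 2 := by
    simp only [t, map_div₀, map_add, map_neg, hr2, map_ofNat]; ring
  have hirr : Irreducible (X ^ 2 - C t : K₀[X]) := by
    refine X_pow_sub_C_irreducible_of_prime Nat.prime_two ?_
    intro b hb
    have h := congrArg ι₂ hb
    rw [ht2, map_pow] at h
    have := Real.sqrt_nonneg 53
    nlinarith [sq_nonneg (ι₂ b)]
  have : Fact (Irreducible (X ^ 2 - C t : K₀[X])) := ⟨hirr⟩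
  let K := AdjoinRoot (X ^ 2 - C t : K₀[X])
  let φ : K →+* ℝ := AdjoinRoot.lift ι₁ θ (by simp [ht1, hθ])
  let ψ : K →+* ℝ := AdjoinRoot.lift ι₁ (-θ) (by simp [ht1, hθ])
  obtain ⟨Ω, hΩ, i, j, hij⟩ := @common_ext53 K ℝ ℝ _ _ _ φ.toAlgebra ψ.toAlgebra
  have hij' : ∀ x : K, i (φ x) = j (ψ x) := hij
  refine ⟨Ω, hΩ, i, j, ?_, ?_⟩
  · have h := hij' (AdjoinRoot.of _ t)
    have h1 : φ (AdjoinRoot.of _ t) = ι₁ t := AdjoinRoot.lift_of _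
    have h2 : ψ (AdjoinRoot.of _ t) = ι₁ t := AdjoinRoot.lift_of _
    rw [h1, h2, ht1, map_sub, map_sub, map_ofNat, map_ofNat] at h
    exact sub_left_inj.mp h
  · have h := hij' (AdjoinRoot.root _)
    have h1 : φ (AdjoinRoot.root _) = θ := AdjoinRoot.lift_root _
    have h2 : ψ (AdjoinRoot.root _) = -θ := AdjoinRoot.lift_root _
    rw [h1, h2] at h
    simpa using h

/-! ### Explicit polynomials -/

/-- `w` as a constant polynomial. -/
def W53 : ℝ[X] := C w53

theorem w53_sq : w53 ^ 2 = w53 + 13 := by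
  have s53 : Real.sqrt 53 ^ 2 = 53 := Real.sq_sqrt (by norm_num)
  unfold w53
  linear_combination s53 / 4

theorem W53_sq : W53 ^ 2 = W53 + 13 := by
  have h := congrArg (C : ℝ → ℝ[X]) w53_sq
  rw [map_pow, map_add, map_ofNat] at h
  exact h

theorem Q53_eq : Q53 = (0+1*W53)*X^3 + (0+1*W53)*X^2 + (1+1*W53) := by
  simp only [Q53, W53, map_add, map_one]; ring

theorem P53_eq : P53 = (-4)*X^6 + (-17+1*W53)*X^5 + (-27+12*W53)*X^4 + (-122+5*W53)*X^3 + (-25+45*W53)*X^2 + (-137-9*W53)*X^1 + (9+14*W53) := by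
  simp only [P53, W53, map_add, map_sub, map_neg, map_mul, map_ofNat]; ring

/-- the polynomial `x² - wx + 3` -/
def g53 : ℝ[X] :=
  (1)*X^2 + (0-1*W53)*X^1 + (3)

/-- the `y`-coordinate of the points, as a function of `x` -/
def r53 : ℝ[X] :=
  (-12-6*W53)*X^1 + (18+2*W53)

/-- cofactor of `g53` in the norm of `y - r` -/
def k53 : ℝ[X] :=
  (4)*X^4 + (17+3*W53)*X^3 + (-24-10*W53)*X^2 + (-111-46*W53)*X^1 + (137+28*W53)

/-- the constant term of the function with divisor `7D` -/
def A53 : ℝ[X] :=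
  (-47+21*W53)*X^7 + (-598+91*W53)*X^6 + (-2165+423*W53)*X^5 + (-2514+2059*W53)*X^4 + (-16320-632*W53)*X^3 + (5334+5742*W53)*X^2 + (-13435-2568*W53)*X^1 + (3555+1385*W53)

/-- the `y`-coefficient of the function with divisor `7D` -/
def B53 : ℝ[X] :=
  (26)*X^4 + (-127-29*W53)*X^3 + (45+202*W53)*X^2 + (-1234-40*W53)*X^1 + (26+195*W53)

theorem id1_53 : r53 ^ 2 + r53 * Q53 - P53 = g53 * k53 := by
  rw [Q53_eq, P53_eq]
  unfold g53 r53 k53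
  linear_combination ((6)*W53^0*X^0 + (-2)*W53^0*X^1 + (-8)*W53^0*X^2 + (-14)*W53^0*X^3 + (-3)*W53^0*X^4) * W53_sq

theorem id2_53 : ((272-516*W53)*X^3 + (-7571-2852*W53)*X^2 + (-12215-4070*W53)*X^1 + (28865+3838*W53)) * g53 + ((-68+129*W53)*X^1 + (-753+58*W53)) * (k53) = 4546 := by
  unfold g53 k53
  linear_combination ((1624)*W53^0*X^0 + (-2894)*W53^0*X^1 + (-2444)*W53^0*X^2 + (1736)*W53^0*X^3 + (903)*W53^0*X^4) * W53_sq

theorem id3_53 : ((-26-6*W53)*X^2 + (-91-28*W53)*X^1 + (135+29*W53)) * g53 + ((4+2*W53)*X^1 + (-9-1*W53)) * (Q53 + 2 * r53) = 7 := by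
  rw [Q53_eq]
  unfold g53 r53
  linear_combination ((-5)*W53^0*X^0 + (-7)*W53^0*X^1 + (3)*W53^0*X^2 + (7)*W53^0*X^3 + (2)*W53^0*X^4) * W53_sq

theorem id4_53 : A53 + B53 * r53 = g53 * ((-47+21*W53)*X^5 + (-325+65*W53)*X^4 + (-1491-56*W53)*X^3 + (1987+1653*W53)*X^2 + (-9694-1564*W53)*X^1 + (3031+1779*W53)) := by
  unfold A53 B53 g53 r53
  linear_combination ((390)*W53^0*X^0 + (529)*W53^0*X^1 + (-920)*W53^0*X^2 + (383)*W53^0*X^3 + (118)*W53^0*X^4 +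
    (65)*W53^0*X^5 + (21)*W53^0*X^6) * W53_sq

theorem id5a_53 : A53 - B53 * (Q53 + r53) = g53 * ((-47-5*W53)*X^5 + (-286+169*W53)*X^4 + (-1764+386*W53)*X^3 + (-3024-161*W53)*X^2 + (4704+1003*W53)*X^1 + (-1751-992*W53)) + ((85-72*W53)*X^1 + (709-7*W53)) := by
  rw [Q53_eq]
  unfold A53 B53 g53 r53
  linear_combination ((-585)*W53^0*X^0 + (298)*W53^0*X^1 + (-38)*W53^0*X^2 + (983)*W53^0*X^3 + (50)*W53^0*X^4 +
    (-4)*W53^0*X^5 + (24)*W53^0*X^6) * W53_sq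

theorem id5b_53 : ((-161310903-54354859*W53)) * g53 + ((-799149-244913*W53)*X^1 + (728403+239549*W53)) * ((85-72*W53)*X^1 + (709-7*W53)) = 10706059 := by
  unfold g53
  linear_combination ((-1676843)*W53^0*X^0 + (38821722)*W53^0*X^1 + (17633736)*W53^0*X^2) * W53_sq

theorem id6_53 : A53 ^ 2 - A53 * B53 * Q53 - B53 ^ 2 * P53 = (3548-857*W53) * g53 ^ 7 := by
  rw [Q53_eq, P53_eq]
  unfold A53 B53 g53
  linear_combination ((-367695)*W53^0*X^0 + (6932042)*W53^0*X^1 + (-12380084)*W53^0*X^2 + (3293988)*W53^0*X^3 +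
    (-32324894)*W53^0*X^4 + (-7865711)*W53^0*X^5 + (-23212584)*W53^0*X^6 + (-10461888)*W53^0*X^7 +
    (-5481359)*W53^0*X^8 + (-2687704)*W53^0*X^9 + (-635309)*W53^0*X^10 + (-210971)*W53^0*X^11 +
    (-35882)*W53^0*X^12 + (-3176)*W53^0*X^13 + (-105)*W53^0*X^14 + (-802425)*W53^1*X^0 +
    (1116785)*W53^1*X^1 + (-375829)*W53^1*X^2 + (10446766)*W53^1*X^3 + (7820508)*W53^1*X^4 +
    (16425980)*W53^1*X^5 + (10540298)*W53^1*X^6 + (7865915)*W53^1*X^7 + (4249127)*W53^1*X^8 +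
    (1317812)*W53^1*X^9 + (536473)*W53^1*X^10 + (86466)*W53^1*X^11 + (17003)*W53^1*X^12 +
    (609)*W53^1*X^13 + (-2429595)*W53^2*X^3 + (-2542995)*W53^2*X^4 + (-4836510)*W53^2*X^5 +
    (-3100188)*W53^2*X^6 + (-2767747)*W53^2*X^7 + (-1033396)*W53^2*X^8 + (-537390)*W53^2*X^9 +
    (-94185)*W53^2*X^10 + (-29995)*W53^2*X^11 + (809865)*W53^3*X^4 + (508599)*W53^3*X^5 +
    (987315)*W53^3*X^6 + (365599)*W53^3*X^7 + (329105)*W53^3*X^8 + (56511)*W53^3*X^9 +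
    (29995)*W53^3*X^10 + (-161973)*W53^4*X^5 + (-56511)*W53^4*X^6 + (-116432)*W53^4*X^7 +
    (-18837)*W53^4*X^8 + (-17997)*W53^4*X^9 + (17997)*W53^5*X^6 + (2691)*W53^5*X^7 +
    (5999)*W53^5*X^8 + (-857)*W53^6*X^7) * W53_sq

theorem id7_53 : ((3548-857*W53) * (2691+857*W53) : ℝ[X]) = -169 := by
  linear_combination ((-734449)*W53^0*X^0) * W53_sq

theorem coprime_of53 (u g v h : ℝ[X]) (m : ℝ) (hm : m ≠ 0) (H : u * g + v * h = C m) :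
    IsCoprime g h := by
  refine ⟨C m⁻¹ * u, C m⁻¹ * v, ?_⟩
  rw [mul_assoc, mul_assoc, ← mul_add, H, ← C_mul, inv_mul_cancel₀ hm, C_1]

theorem coprime_k53 : IsCoprime g53 (k53) :=
  coprime_of53 _ _ _ _ 4546 (by norm_num) (id2_53.trans (map_ofNat C 4546).symm)

theorem coprime_Q53 : IsCoprime g53 (Q53 + 2 * r53) :=
  coprime_of53 _ _ _ _ 7 (by norm_num) (id3_53.trans (map_ofNat C 7).symm)

theorem coprime_H53' : IsCoprime g53 ((85-72*W53)*X^1 + (709-7*W53)) :=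
  coprime_of53 _ _ _ _ 10706059 (by norm_num) (id5b_53.trans (map_ofNat C 10706059).symm)

theorem coprime_H53 : IsCoprime g53 (A53 - B53 * (Q53 + r53)) := by
  rw [id5a_53]
  exact coprime_H53'.mul_add_left_right _

/-! ### The coordinate ring -/

/-- The inclusion of `ℝ[x]` in the coordinate ring. -/
def o53 : ℝ[X] →+* CoordRing53 := AdjoinRoot.of _

/-- The function `y`. -/
def y53 : CoordRing53 := AdjoinRoot.root _

theorem g53_eq : (X ^ 2 - C w53 * X + C 3 : ℝ[X]) = g53 := by
  simp only [g53, W53, map_ofNat]; ring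

theorem r53_eq : (C (-6 * w53 - 12) * X + C (2 * w53 + 18) : ℝ[X]) = r53 := by
  simp only [r53, W53, map_add, map_sub, map_neg, map_mul, map_ofNat]; ring

theorem I53_eq : I53 = Ideal.span {o53 g53, y53 - o53 r53} := by
  unfold I53
  rw [g53_eq, r53_eq]
  rfl

theorem y53_sq : y53 ^ 2 = o53 P53 - o53 Q53 * y53 := by
  have h := AdjoinRoot.eval₂_root (X ^ 2 + C Q53 * X - C P53 : Polynomial (Polynomial ℝ))
  simp only [eval₂_sub, eval₂_add, eval₂_mul, eval₂_pow, eval₂_X, eval₂_C] at h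
  change y53 ^ 2 + o53 Q53 * y53 - o53 P53 = 0 at h
  linear_combination h

theorem deg53 : (X ^ 2 + C Q53 * X - C P53 : Polynomial (Polynomial ℝ)).degree = 2 := by
  have h : (X ^ 2 + C Q53 * X - C P53 : Polynomial (Polynomial ℝ)) =
    C 1 * X ^ 2 + C Q53 * X + C (-P53) := by simp [sub_eq_add_neg]
  rw [h]
  exact degree_quadratic one_ne_zero

theorem monic53 : (X ^ 2 + C Q53 * X - C P53 : Polynomial (Polynomial ℝ)).Monic := by
  have h : (X ^ 2 + C Q53 * X - C P53 : Polynomial (Polynomial ℝ)) =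
    C 1 * X ^ 2 + C Q53 * X + C (-P53) := by simp [sub_eq_add_neg]
  rw [Monic, h]
  exact leadingCoeff_quadratic one_ne_zero

theorem mk_lin53 (a b : ℝ[X]) : o53 a + o53 b * y53 =
    AdjoinRoot.mk (X ^ 2 + C Q53 * X - C P53 : Polynomial (Polynomial ℝ)) (C b * X + C a) := by
  have h1 : ∀ c, o53 c =
    AdjoinRoot.mk (X ^ 2 + C Q53 * X - C P53 : Polynomial (Polynomial ℝ)) (C c) := fun _ => rfl
  have h2 : y53 = AdjoinRoot.mk (X ^ 2 + C Q53 * X - C P53 : Polynomial (Polynomial ℝ)) X := rfl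
  rw [h1, h1, h2, ← map_mul, ← map_add, add_comm (C a)]

theorem exists_coord53 (z : CoordRing53) : ∃ a b : ℝ[X], z = o53 a + o53 b * y53 := by
  obtain ⟨p, rfl⟩ := AdjoinRoot.mk_surjective z
  have h1 : AdjoinRoot.mk (X ^ 2 + C Q53 * X - C P53 : Polynomial (Polynomial ℝ)) p =
      AdjoinRoot.mk _ (p %ₘ (X ^ 2 + C Q53 * X - C P53)) := by
    rw [AdjoinRoot.mk_eq_mk]
    refine ⟨p /ₘ (X ^ 2 + C Q53 * X - C P53), ?_⟩
    have := modByMonic_add_div p (X ^ 2 + C Q53 * X - C P53 : Polynomial (Polynomial ℝ))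
    linear_combination -this
  have h2 : (p %ₘ (X ^ 2 + C Q53 * X - C P53)).degree ≤ 1 := by
    have := degree_modByMonic_lt p monic53
    rw [deg53] at this
    exact Order.le_of_lt_succ this
  rw [h1, eq_X_add_C_of_degree_le_one h2]
  exact ⟨_, _, (mk_lin53 _ _).symm⟩

theorem coord_zero53 {a b : ℝ[X]} (h : o53 a + o53 b * y53 = 0) : a = 0 ∧ b = 0 := by
  rw [mk_lin53] at h
  have h1 := AdjoinRoot.mk_eq_zero.mp h
  have h2 : (C b * X + C a : Polynomial (Polynomial ℝ)) = 0 := by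
    by_contra hne
    refine monic53.not_dvd_of_degree_lt hne ?_ h1
    rw [deg53]
    exact degree_linear_lt
  constructor
  · simpa using congrArg (fun p => coeff p 0) h2
  · simpa using congrArg (fun p => coeff p 1) h2

theorem coord_inj53 {a b a' b' : ℝ[X]} (h : o53 a + o53 b * y53 = o53 a' + o53 b' * y53) :
    a = a' ∧ b = b' := by
  have h1 : o53 (a - a') + o53 (b - b') * y53 = 0 := by
    rw [map_sub, map_sub]; linear_combination h
  obtain ⟨h2, h3⟩ := coord_zero53 h1
  exact ⟨sub_eq_zero.mp h2, sub_eq_zero.mp h3⟩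

theorem coord_mul53 (a b p q : ℝ[X]) : (o53 a + o53 b * y53) * (o53 p + o53 q * y53) =
    o53 (a * p + b * q * P53) + o53 (a * q + b * p - b * q * Q53) * y53 := by
  simp only [map_add, map_sub, map_mul]
  linear_combination (o53 b * o53 q) * y53_sq

theorem nzd53 {p : ℝ[X]} (hp : p ≠ 0) {z : CoordRing53} (h : o53 p * z = 0) : z = 0 := by
  obtain ⟨a, b, rfl⟩ := exists_coord53 z
  have h1 : o53 (p * a) + o53 (p * b) * y53 = 0 := by
    rw [map_mul, map_mul]; linear_combination h
  obtain ⟨h2, h3⟩ := coord_zero53 h1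
  rw [(mul_eq_zero.mp h2).resolve_left hp, (mul_eq_zero.mp h3).resolve_left hp]
  simp

theorem g53_monic : g53.Monic := by
  rw [← g53_eq]; monicity!

theorem g53_natDegree : g53.natDegree = 2 := by
  rw [← g53_eq]; compute_degree!

/-! ### `I ^ 7` is principal -/

theorem mem_pow_of53 {S : Type} [CommRing S] (I : Ideal S) (f f' c G i e : S) (hi : i ∈ I)
    (h1 : i + e * f' = 1) (hf : f ∈ I) (hff : f * f' = c * G) (hG : G ∈ I ^ 7) : f ∈ I ^ 7 := by
  have key : ∀ j : ℕ, j ≤ 6 → f ∈ I ^ (j + 1) := by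
    intro j
    induction j with
    | zero => intro _; simpa using hf
    | succ j ih =>
      intro hj
      have h2 : f = f * i + (e * c) * G := by linear_combination e * hff - f * h1
      rw [h2, pow_succ I (j + 1)]
      refine Ideal.add_mem _ (Ideal.mul_mem_mul (ih (by omega)) hi) ?_
      rw [← pow_succ]
      exact Ideal.mul_mem_left _ _ (Ideal.pow_le_pow_right (by omega) hG)
  exact key 6 le_rfl

theorem gen_mem53 {S : Type} [CommRing S] (o : ℝ[X] →+* S) (y y' : S)
    (hsum : y + y' = -o Q53) (hprod : y * y' = -o P53) :
    o A53 + o B53 * y ∈ (Ideal.span {o g53, y - o r53} : Ideal S) ^ 7 := by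
  obtain ⟨u, v, huv⟩ := coprime_H53
  have hg : o g53 ∈ (Ideal.span {o g53, y - o r53} : Ideal S) := Ideal.subset_span (by simp)
  have hy : y - o r53 ∈ (Ideal.span {o g53, y - o r53} : Ideal S) := Ideal.subset_span (by simp)
  have huv' := congrArg o huv
  have h4 := congrArg o id4_53
  have h6 := congrArg o id6_53
  simp only [map_add, map_sub, map_mul o, map_pow, map_one] at huv' h4 h6
  refine mem_pow_of53 _ _ (o A53 + o B53 * y') (o (3548-857*W53)) (o g53 ^ 7)
    (o u * o g53 + o v * o B53 * (y - o r53)) (o v) ?_ ?_ ?_ ?_ ?_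
  · exact Ideal.add_mem _ (Ideal.mul_mem_left _ _ hg) (Ideal.mul_mem_left _ _ hy)
  · linear_combination huv' + o v * o B53 * hsum
  · have : o A53 + o B53 * y = (o A53 + o B53 * o r53) + o B53 * (y - o r53) := by ring
    rw [this, h4]
    exact Ideal.add_mem _ (Ideal.mul_mem_right _ _ hg) (Ideal.mul_mem_left _ _ hy)
  · rw [map_sub, map_mul o]
    linear_combination h6 + o A53 * o B53 * hsum + o B53 ^ 2 * hprod
  · exact Ideal.pow_mem_pow hg 7

theorem N7_ne53 : ((3548-857*W53) * g53 ^ 7 : ℝ[X]) ≠ 0 := by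
  refine mul_ne_zero ?_ (pow_ne_zero 7 g53_monic.ne_zero)
  intro h
  have h7 := id7_53
  rw [h, zero_mul] at h7
  have := congrArg (eval 0) h7
  norm_num at this

/-- The generator of `I ^ 7`. -/
def f53 : CoordRing53 := o53 A53 + o53 B53 * y53

/-- The conjugate of the generator of `I ^ 7`. -/
def f53' : CoordRing53 := o53 A53 + o53 B53 * (-o53 Q53 - y53)

theorem f53_mul : f53 * f53' = o53 ((3548-857*W53) * g53 ^ 7) := by
  rw [← id6_53]
  simp only [f53, f53', map_sub, map_mul, map_pow]
  linear_combination (-o53 B53 ^ 2) * y53_sq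

theorem I7_53 : I53 ^ 7 = Ideal.span {f53} := by
  have hsum : y53 + (-o53 Q53 - y53) = -o53 Q53 := by ring
  have hprod : y53 * (-o53 Q53 - y53) = -o53 P53 := by linear_combination -y53_sq
  have h1 : f53 ∈ I53 ^ 7 := by
    rw [I53_eq]; exact gen_mem53 o53 y53 (-o53 Q53 - y53) hsum hprod
  set J : Ideal CoordRing53 := Ideal.span {o53 g53, (-o53 Q53 - y53) - o53 r53} with hJ
  have h2 : f53' ∈ J ^ 7 :=
    gen_mem53 o53 (-o53 Q53 - y53) y53 (by rw [← hsum]; ring) (by rw [← hprod]; ring)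
  have hIJ : I53 * J ≤ Ideal.span {o53 g53} := by
    rw [I53_eq, hJ, Ideal.span_mul_span', Ideal.span_le]
    have id1 := congrArg o53 id1_53
    simp only [map_add, map_sub, map_mul, map_pow] at id1
    rintro _ ⟨a, ha, b, hb, rfl⟩
    simp only [Set.mem_insert_iff, Set.mem_singleton_iff] at ha hb
    rw [SetLike.mem_coe, Ideal.mem_span_singleton]
    rcases ha with rfl | rfl
    · exact ⟨b, rfl⟩
    · rcases hb with rfl | rfl
      · exact ⟨_, mul_comm _ _⟩
      · refine ⟨o53 k53, ?_⟩
        rw [← id1]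
        linear_combination -y53_sq
  apply le_antisymm
  · intro z hz
    have h3 : z * f53' ∈ Ideal.span {o53 g53 ^ 7} := by
      have h4 := Ideal.mul_mem_mul hz h2
      rw [← mul_pow] at h4
      have h5 := Ideal.pow_right_mono hIJ 7 h4
      rwa [Ideal.span_singleton_pow] at h5
    obtain ⟨u, hu⟩ := Ideal.mem_span_singleton.mp h3
    rw [Ideal.mem_span_singleton]
    have h7 := congrArg o53 id7_53
    -- the inverse of the constant
    have hinv : o53 (3548-857*W53) * (o53 (C (-169 : ℝ)⁻¹) * o53 (2691+857*W53)) = 1 := by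
      have : (3548-857*W53) * (C (-169 : ℝ)⁻¹ * (2691+857*W53)) = (1 : ℝ[X]) := by
        have e : (-169 : ℝ[X]) = C (-169) := by rw [map_neg, map_ofNat]
        rw [mul_left_comm, id7_53, e, ← C_mul]; norm_num
      rw [← map_mul, ← map_mul, this, map_one]
    refine ⟨u * (o53 (C (-169 : ℝ)⁻¹) * o53 (2691+857*W53)), ?_⟩
    rw [← sub_eq_zero]
    apply nzd53 N7_ne53
    rw [← f53_mul]
    have hm := f53_mul
    rw [map_mul, map_pow] at hm
    linear_combination f53 * hu - u * (o53 (C (-169 : ℝ)⁻¹) * o53 (2691+857*W53)) * f53 * hm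
      - f53 * u * o53 g53 ^ 7 * hinv
  · rw [Ideal.span_le, Set.singleton_subset_iff]
    exact h1

/-! ### `I` is not principal -/

theorem Q53_natDegree : Q53.natDegree ≤ 3 := by
  unfold Q53; compute_degree

theorem Q53_coeff : Q53.coeff 3 = w53 := by
  unfold Q53
  simp only [coeff_add, coeff_C_mul, coeff_X_pow, coeff_C]
  norm_num

theorem P53_natDegree : P53.natDegree ≤ 6 := by
  unfold P53; compute_degree

theorem P53_coeff : P53.coeff 6 = -4 := by
  unfold P53
  simp only [coeff_add, coeff_C_mul, coeff_X_pow, coeff_X, coeff_C]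
  norm_num

/-- The polynomial core: no element `a + b y` of norm dividing `g` divides `y - r`. -/
theorem core53 (a b p q : ℝ[X]) (h0 : a * p + b * q * P53 = -r53)
    (h1 : a * q + b * p - b * q * Q53 = 1)
    (hgN : g53 ∣ a ^ 2 - a * b * Q53 - b ^ 2 * P53)
    (hNg : a ^ 2 - a * b * Q53 - b ^ 2 * P53 ∣ g53) : False := by
  have hdN : (a ^ 2 - a * b * Q53 - b ^ 2 * P53).natDegree ≤ 2 :=
    (natDegree_le_of_dvd hNg g53_monic.ne_zero).trans g53_natDegree.le
  have hw := w53_sq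
  -- `b ≠ 0`
  have hb : b ≠ 0 := by
    rintro rfl
    have hu : IsUnit a := IsUnit.of_mul_eq_one q (by linear_combination h1)
    have hg : IsUnit g53 := by
      refine isUnit_of_dvd_unit hgN ?_
      have : a ^ 2 - a * 0 * Q53 - 0 ^ 2 * P53 = a ^ 2 := by ring
      rw [this]; exact hu.pow 2
    have := natDegree_eq_zero_of_isUnit hg
    rw [g53_natDegree] at this
    omega
  set n := b.natDegree with hn
  have hb0 : b.coeff n ≠ 0 := by rw [hn, coeff_natDegree]; exact leadingCoeff_ne_zero.mpr hb
  -- the degree of `a`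
  have ha : a.natDegree ≤ n + 3 := by
    by_contra hlt
    push Not at hlt
    have e1 : (a * b * Q53).natDegree < 2 * a.natDegree := by
      refine (natDegree_mul_le_of_le (natDegree_mul_le_of_le le_rfl le_rfl)
        Q53_natDegree).trans_lt ?_
      omega
    have e2 : (b ^ 2 * P53).natDegree < 2 * a.natDegree := by
      refine (natDegree_mul_le_of_le (natDegree_pow_le_of_le 2 le_rfl)
        P53_natDegree).trans_lt ?_
      omega
    have e3 : (a ^ 2 - a * b * Q53 - b ^ 2 * P53).coeff (2 * a.natDegree) ≠ 0 := by
      rw [coeff_sub, coeff_sub, coeff_eq_zero_of_natDegree_lt e1, coeff_eq_zero_of_natDegree_lt e2,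
        coeff_pow_of_natDegree_le le_rfl, sub_zero, sub_zero]
      refine pow_ne_zero 2 ?_
      rw [coeff_natDegree]
      refine leadingCoeff_ne_zero.mpr ?_
      rintro rfl
      simp at hlt
    have := le_natDegree_of_ne_zero e3
    omega
  -- the leading coefficients
  have hlead : a.coeff (n + 3) ^ 2 - a.coeff (n + 3) * b.coeff n * w53 + 4 * b.coeff n ^ 2 = 0 := by
    have e0 : (a ^ 2 - a * b * Q53 - b ^ 2 * P53).coeff (2 * (n + 3)) = 0 :=
      coeff_eq_zero_of_natDegree_lt (by omega)
    have hab : (a * b).natDegree ≤ n + 3 + n := natDegree_mul_le_of_le ha le_rfl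
    have hbb : (b ^ 2).natDegree ≤ 2 * n := natDegree_pow_le_of_le 2 le_rfl
    have e1 : (a * b * Q53).coeff (2 * (n + 3)) = a.coeff (n + 3) * b.coeff n * w53 := by
      rw [← Q53_coeff, ← coeff_mul_add_eq_of_natDegree_le ha le_rfl, ← hn,
        ← coeff_mul_add_eq_of_natDegree_le hab Q53_natDegree]; congr 1; ring
    have e2 : (b ^ 2 * P53).coeff (2 * (n + 3)) = b.coeff n ^ 2 * (-4) := by
      rw [← P53_coeff, ← coeff_pow_of_natDegree_le (m := 2) hn.ge,
        ← coeff_mul_add_eq_of_natDegree_le hbb P53_natDegree]; congr 1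
    rw [coeff_sub, coeff_sub, e1, e2, coeff_pow_of_natDegree_le ha] at e0
    linear_combination e0
  set s : ℝ := -(a.coeff (n + 3) / b.coeff n) with hs
  have ha0 : a.coeff (n + 3) = -(b.coeff n * s) := by rw [hs]; field_simp
  have hs2 : s ^ 2 + s * w53 + 4 = 0 := by
    rw [ha0] at hlead
    have : b.coeff n ^ 2 * (s ^ 2 + s * w53 + 4) = 0 := by linear_combination hlead
    exact (mul_eq_zero.mp this).resolve_left (pow_ne_zero 2 hb0)
  have hθ : (2 * s + w53) ^ 2 = w53 - 3 := by linear_combination 4 * hs2 + hw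
  obtain ⟨L, _, i, j, hij, hθij⟩ := two_embeddings53 (2 * s + w53) hθ
  have hθ0 : 2 * s + w53 ≠ 0 := by
    intro h
    rw [h] at hθ
    have : w53 = 3 := by linear_combination -hθ
    rw [this] at hw
    norm_num at hw
  have h2 : (2 : L) ≠ 0 := by
    have : i 2 ≠ 0 := (map_ne_zero i).mpr two_ne_zero
    rwa [map_ofNat] at this
  have hsum2 : 2 * (i s + j s + i w53) = 0 := by
    have h := hθij
    rw [map_add, map_add, map_mul, map_mul, map_ofNat, map_ofNat, ← hij] at h
    linear_combination h
  have hsum : i s + j s = -i w53 := by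
    linear_combination (mul_eq_zero.mp hsum2).resolve_left h2
  have hi2 : i s ^ 2 + i s * i w53 + 4 = 0 := by
    have := congrArg i hs2
    simpa only [map_add, map_mul, map_pow, map_ofNat, map_zero] using this
  have hprod : i s * j s = 4 := by linear_combination i s * hsum - hi2
  have hne : i s ≠ j s := by
    intro h
    have h3 : i (2 * s + w53) = 0 := by
      rw [map_add, map_mul, map_ofNat]; linear_combination hsum + h
    exact hθ0 ((map_eq_zero i).mp h3)
  -- equality of the images of the defining polynomials
  have hWm : W53.map i = W53.map j := by simp only [W53, map_C, hij]
  have hQm : Q53.map i = Q53.map j := by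
    rw [Q53_eq]
    simp only [Polynomial.map_add, Polynomial.map_sub, Polynomial.map_neg, Polynomial.map_mul,
      Polynomial.map_pow, map_X, Polynomial.map_one, Polynomial.map_zero, Polynomial.map_ofNat, hWm]
  have hPm : P53.map i = P53.map j := by
    rw [P53_eq]
    simp only [Polynomial.map_add, Polynomial.map_sub, Polynomial.map_neg, Polynomial.map_mul,
      Polynomial.map_pow, map_X, Polynomial.map_one, Polynomial.map_zero, Polynomial.map_ofNat, hWm]
  have hgm : g53.map i = g53.map j := by
    unfold g53
    simp only [Polynomial.map_add, Polynomial.map_sub, Polynomial.map_neg, Polynomial.map_mul,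
      Polynomial.map_pow, map_X, Polynomial.map_one, Polynomial.map_zero, Polynomial.map_ofNat, hWm]
  have hrm : r53.map i = r53.map j := by
    unfold r53
    simp only [Polynomial.map_add, Polynomial.map_sub, Polynomial.map_neg, Polynomial.map_mul,
      Polynomial.map_pow, map_X, Polynomial.map_one, Polynomial.map_zero, Polynomial.map_ofNat, hWm]
  have hNi : (a.map i) ^ 2 - a.map i * b.map i * Q53.map i - (b.map i) ^ 2 * P53.map i =
      (a ^ 2 - a * b * Q53 - b ^ 2 * P53).map i := by
    simp only [Polynomial.map_sub, Polynomial.map_mul, Polynomial.map_pow]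
  have hNj : (a.map j) ^ 2 - a.map j * b.map j * Q53.map i - (b.map j) ^ 2 * P53.map i =
      (a ^ 2 - a * b * Q53 - b ^ 2 * P53).map j := by
    rw [hQm, hPm]
    simp only [Polynomial.map_sub, Polynomial.map_mul, Polynomial.map_pow]
  have hB := degree_arg53 (i w53) (i s) (j s) hne hsum hprod (Q53.map i) (P53.map i)
    (a.map i) (b.map i) (a.map j) (b.map j) _ _ n
    (natDegree_map_le.trans Q53_natDegree) (by rw [coeff_map, Q53_coeff])
    (natDegree_map_le.trans P53_natDegree) (by rw [coeff_map, P53_coeff, map_neg, map_ofNat])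
    (natDegree_map_le.trans ha) (natDegree_map_le.trans ha)
    (natDegree_map_le.trans hn.ge) (natDegree_map_le.trans hn.ge)
    (by rw [coeff_map]; exact (map_ne_zero i).mpr hb0)
    (by rw [coeff_map]; exact (map_ne_zero j).mpr hb0)
    (by rw [coeff_map, coeff_map, ha0, map_neg, map_mul])
    (by rw [coeff_map, coeff_map, ha0, map_neg, map_mul])
    hNi hNj (natDegree_map_le.trans hdN) (natDegree_map_le.trans hdN)
  -- the norm of the product
  set A := a.map i * a.map j + b.map i * b.map j * P53.map i with hA
  have hA2 : A ^ 2 = (a ^ 2 - a * b * Q53 - b ^ 2 * P53).map i *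
      (a ^ 2 - a * b * Q53 - b ^ 2 * P53).map j := by
    rw [← hNi, ← hNj, hA]
    linear_combination (A * Q53.map i + (a.map i * b.map j + a.map j * b.map i -
      b.map i * b.map j * Q53.map i) * P53.map i) * hB
  have hgA : g53.map i ∣ A := by
    rw [← UniqueFactorizationMonoid.pow_dvd_pow_iff_dvd two_ne_zero, hA2, sq]
    refine mul_dvd_mul (Polynomial.map_dvd i hgN) ?_
    rw [hgm]
    exact Polynomial.map_dvd j hgN
  -- the `y`-coefficient of `(y - r) ^ 2`
  have hi0 : a.map i * p.map i + b.map i * q.map i * P53.map i = -r53.map i := by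
    have := congrArg (Polynomial.map i) h0
    simpa only [Polynomial.map_add, Polynomial.map_mul, Polynomial.map_neg] using this
  have hi1 : a.map i * q.map i + b.map i * p.map i - b.map i * q.map i * Q53.map i = 1 := by
    have := congrArg (Polynomial.map i) h1
    simpa only [Polynomial.map_add, Polynomial.map_sub, Polynomial.map_mul,
      Polynomial.map_one] using this
  have hj0 : a.map j * p.map j + b.map j * q.map j * P53.map i = -r53.map i := by
    have := congrArg (Polynomial.map j) h0
    rw [hPm, hrm]
    simpa only [Polynomial.map_add, Polynomial.map_mul, Polynomial.map_neg] using this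
  have hj1 : a.map j * q.map j + b.map j * p.map j - b.map j * q.map j * Q53.map i = 1 := by
    have := congrArg (Polynomial.map j) h1
    rw [hQm]
    simpa only [Polynomial.map_add, Polynomial.map_sub, Polynomial.map_mul,
      Polynomial.map_one] using this
  have hdiv : g53.map i ∣ (Q53 + 2 * r53).map i := by
    have e : (Q53 + 2 * r53).map i = -(A * (p.map i * q.map j + q.map i * p.map j -
        q.map i * q.map j * Q53.map i)) := by
      rw [Polynomial.map_add, Polynomial.map_mul, Polynomial.map_ofNat]
      rw [hA]
      linear_combination (a.map j * q.map j + b.map j * p.map j - b.map j * q.map j * Q53.map i) * hi0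
        - r53.map i * hj1 + (a.map j * p.map j + b.map j * q.map j * P53.map i) * hi1 + hj0
        - Q53.map i * ((a.map j * q.map j + b.map j * p.map j
          - b.map j * q.map j * Q53.map i) * hi1 + hj1)
        - (p.map i * p.map j + q.map i * q.map j * P53.map i - (p.map i * q.map j
          + q.map i * p.map j - q.map i * q.map j * Q53.map i) * Q53.map i) * hB
    rw [e]
    exact (hgA.mul_right _).neg_right
  have hcop := coprime_Q53.map (mapRingHom i)
  have hu : IsUnit (g53.map i) := hcop.isUnit_of_dvd' dvd_rfl hdiv
  have := natDegree_eq_zero_of_isUnit hu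
  rw [natDegree_map, g53_natDegree] at this
  omega

theorem not_principal53 : ¬∃ f : CoordRing53, I53 = Ideal.span {f} := by
  rintro ⟨f, hf⟩
  rw [I53_eq] at hf
  obtain ⟨a, b, rfl⟩ := exists_coord53 f
  have hg : o53 a + o53 b * y53 ∣ o53 g53 := by
    rw [← Ideal.mem_span_singleton, ← hf]; exact Ideal.subset_span (by simp)
  have hy : o53 a + o53 b * y53 ∣ y53 - o53 r53 := by
    rw [← Ideal.mem_span_singleton, ← hf]; exact Ideal.subset_span (by simp)
  have hm : o53 a + o53 b * y53 ∈ Ideal.span {o53 g53, y53 - o53 r53} := by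
    rw [hf]; exact Ideal.mem_span_singleton_self _
  obtain ⟨h, hh⟩ := hg
  obtain ⟨h', hh'⟩ := hy
  obtain ⟨c, d, hcd⟩ := Ideal.mem_span_pair.mp hm
  obtain ⟨p₁, q₁, rfl⟩ := exists_coord53 h
  obtain ⟨p, q, rfl⟩ := exists_coord53 h'
  obtain ⟨c₁, c₂, rfl⟩ := exists_coord53 c
  obtain ⟨d₁, d₂, rfl⟩ := exists_coord53 d
  have e1 : g53 = a * p₁ + b * q₁ * P53 ∧ 0 = a * q₁ + b * p₁ - b * q₁ * Q53 := by
    apply coord_inj53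
    rw [← coord_mul53, ← hh]; simp
  have e2 : -r53 = a * p + b * q * P53 ∧ 1 = a * q + b * p - b * q * Q53 := by
    apply coord_inj53
    rw [← coord_mul53, ← hh']; simp; ring
  have e3 : c₁ * g53 + (d₁ * (-r53) + d₂ * 1 * P53) = a ∧
      c₂ * g53 + (d₁ * 1 + d₂ * (-r53) - d₂ * 1 * Q53) = b := by
    apply coord_inj53
    rw [← hcd]
    simp only [map_add, map_sub, map_mul, map_neg, map_one]
    linear_combination (-o53 d₂) * y53_sq
  set N := a ^ 2 - a * b * Q53 - b ^ 2 * P53 with hN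
  have hgN : g53 ∣ N := by
    have id1 := id1_53
    obtain ⟨e4, e5⟩ := e3
    rw [hN, ← e4, ← e5]
    refine ⟨c₁ * (2 * (d₁ * (-r53) + d₂ * 1 * P53)) + c₁ ^ 2 * g53
      - Q53 * (c₁ * (d₁ * 1 + d₂ * (-r53) - d₂ * 1 * Q53) + c₂ * (d₁ * (-r53) + d₂ * 1 * P53)
        + c₁ * c₂ * g53)
      - P53 * (2 * c₂ * (d₁ * 1 + d₂ * (-r53) - d₂ * 1 * Q53) + c₂ ^ 2 * g53)
      + (d₁ ^ 2 - d₁ * d₂ * Q53 - d₂ ^ 2 * P53) * k53, ?_⟩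
    linear_combination (d₁ ^ 2 - d₁ * d₂ * Q53 - d₂ ^ 2 * P53) * id1
  have hN1 : N ∣ g53 ^ 2 := by
    refine ⟨p₁ ^ 2 - p₁ * q₁ * Q53 - q₁ ^ 2 * P53, ?_⟩
    obtain ⟨e4, e5⟩ := e1
    have : g53 ^ 2 = (a * p₁ + b * q₁ * P53) ^ 2 - (a * p₁ + b * q₁ * P53) *
      (a * q₁ + b * p₁ - b * q₁ * Q53) * Q53 - (a * q₁ + b * p₁ - b * q₁ * Q53) ^ 2 * P53 := by
      rw [← e4, ← e5]; ring
    rw [this, hN]; ring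
  have hN2 : N ∣ g53 * k53 := by
    refine ⟨p ^ 2 - p * q * Q53 - q ^ 2 * P53, ?_⟩
    obtain ⟨e4, e5⟩ := e2
    have : g53 * k53 = (a * p + b * q * P53) ^ 2 - (a * p + b * q * P53) *
      (a * q + b * p - b * q * Q53) * Q53 - (a * q + b * p - b * q * Q53) ^ 2 * P53 := by
      rw [← e4, ← e5, ← id1_53]; ring
    rw [this, hN]; ring
  have hNg : N ∣ g53 := by
    obtain ⟨u, v, huv⟩ := coprime_k53
    have : g53 = u * g53 ^ 2 + v * (g53 * k53) := by linear_combination -g53 * huv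
    rw [this]
    exact dvd_add (hN1.mul_left _) (hN2.mul_left _)
  exact core53 a b p q e2.1.symm e2.2.symm hgN hNg

theorem reduce53 (k m j : ℕ) (hk : k * m = 7 * j + 1)
    (h : ∃ f : CoordRing53, I53 ^ k = Ideal.span {f}) :
    ∃ f : CoordRing53, I53 = Ideal.span {f} := by
  obtain ⟨f, hf⟩ := h
  have h1 : I53 ^ (k * m) = Ideal.span {f ^ m} := by
    rw [pow_mul I53, hf, Ideal.span_singleton_pow]
  rw [hk, pow_succ I53, pow_mul I53, I7_53, Ideal.span_singleton_pow] at h1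
  have hcancel : ∀ z : CoordRing53, f53 ^ j * z = 0 → z = 0 := by
    intro z hz
    refine nzd53 (pow_ne_zero j N7_ne53) ?_
    rw [map_pow, ← f53_mul, mul_pow]
    linear_combination f53' ^ j * hz
  have h2 : f ^ m ∈ Ideal.span {f53 ^ j} * I53 := by
    rw [h1]; exact Ideal.mem_span_singleton_self _
  obtain ⟨e, he, hfe⟩ := Ideal.mem_span_singleton_mul.mp h2
  refine ⟨e, le_antisymm ?_ ?_⟩
  · intro z hz
    have h3 : f53 ^ j * z ∈ Ideal.span {f53 ^ j} * I53 :=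
      Ideal.mul_mem_mul (Ideal.mem_span_singleton_self _) hz
    rw [h1, Ideal.mem_span_singleton] at h3
    obtain ⟨u, hu⟩ := h3
    rw [Ideal.mem_span_singleton]
    refine ⟨u, ?_⟩
    rw [← sub_eq_zero]
    apply hcancel
    rw [← hfe] at hu
    linear_combination hu
  · rw [Ideal.span_le, Set.singleton_subset_iff]
    exact he

/-- the divisor class of `D = P + σ'(P) - 2∞` on the genus 2
curve `C` over `F = ℚ(√53)` of Theorem `ex-sqrt53` has order exactly `7` in
`Pic⁰(C)(F)`: in terms of the ideal `I` of `P + σ'(P)` in the affine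
coordinate ring, `7D ∼ 0` (`I⁷` is principal) while `kD` is not principal for
`1 ≤ k < 7`; hence `D` defines an element of order exactly `7`. -/
theorem stmt10 :
    (∃ f : CoordRing53, I53 ^ 7 = Ideal.span {f}) ∧
    (¬∃ f : CoordRing53, I53 = Ideal.span {f}) ∧
    (∀ k : ℕ, 1 ≤ k → k < 7 → ¬∃ f : CoordRing53, I53 ^ k = Ideal.span {f}) := by
  refine ⟨⟨f53, I7_53⟩, not_principal53, ?_⟩
  intro k hk1 hk7 h
  apply not_principal53
  interval_cases k
  · exact reduce53 1 1 0 (by norm_num) h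
  · exact reduce53 2 4 1 (by norm_num) h
  · exact reduce53 3 5 2 (by norm_num) h
  · exact reduce53 4 2 1 (by norm_num) h
  · exact reduce53 5 3 2 (by norm_num) h
  · exact reduce53 6 6 5 (by norm_num) h

end
end
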